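/- For the Kerr–(anti-)de Sitter black hole, for all m > 0 and all (r, θ) with r² + a²cos²θ > 0, the Abdelqader–Lake invariant Q₃ = (1/(6√3))·(I₅ + I₆)/(I₁² + I₂²)^{5/4} satisfies the closed-form identity Q₃(r, θ) = (−Λa⁴cos⁴θ − 3a²cos²θ + Λa⁴cos²θ − Λa²r² + 6a² − Λr⁴ − 6mr + 3r²)/(6m√(r² + a²cos²θ)). -/

import Mathlib

noncomputable section

namespace KerrAdS

/-- `ρ² = r² + a² cos²θ` in Boyer–Lindquist coordinates. -/
def rho2 (a r θ : ℝ) : ℝ := r ^ 2 + a ^ 2 * Real.cos θ ^ 2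

/-- The complex combination `I₁ + i I₂ = 48 m² (r − i a cos θ)⁶ / ρ¹²`
(the orientation convention `I₁ + iI₂ = 48 Ψ₂²` with `Ψ₂ = −m/(r + i a cos θ)³`). -/
def Ic (a m r θ : ℝ) : ℂ :=
  48 * (m : ℂ) ^ 2 * ((r : ℂ) - Complex.I * ((a * Real.cos θ : ℝ) : ℂ)) ^ 6 /
    ((rho2 a r θ : ℝ) : ℂ) ^ 6

/-- The Weyl invariant `I₁ = C_{αβγδ} C^{αβγδ}` of the Kerr–(anti-)de Sitter black hole. -/
def I1 (a m r θ : ℝ) : ℝ := (Ic a m r θ).re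

/-- The Chern–Pontryagin invariant `I₂ = C*_{αβγδ} C^{αβγδ}`. -/
def I2 (a m r θ : ℝ) : ℝ := (Ic a m r θ).im

/-- `Δ_r = (1 − Λr²/3)(r² + a²) − 2mr`. -/
def Δr (a m Λ r : ℝ) : ℝ := (1 - Λ * r ^ 2 / 3) * (r ^ 2 + a ^ 2) - 2 * m * r

/-- `Δ_θ = 1 + (a²Λ/3) cos²θ`. -/
def Δθ (a Λ θ : ℝ) : ℝ := 1 + a ^ 2 * Λ / 3 * Real.cos θ ^ 2

/-- The gradient invariant `I₅ = ∇_μ I₁ ∇^μ I₁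
  = (Δ_r/ρ²)(∂_r I₁)² + (Δ_θ/ρ²)(∂_θ I₁)²`. -/
def I5 (a m Λ r θ : ℝ) : ℝ :=
  Δr a m Λ r / rho2 a r θ * (deriv (fun r' => I1 a m r' θ) r) ^ 2 +
    Δθ a Λ θ / rho2 a r θ * (deriv (fun θ' => I1 a m r θ') θ) ^ 2

/-- The gradient invariant `I₆ = ∇_μ I₂ ∇^μ I₂
  = (Δ_r/ρ²)(∂_r I₂)² + (Δ_θ/ρ²)(∂_θ I₂)²`. -/
def I6 (a m Λ r θ : ℝ) : ℝ :=
  Δr a m Λ r / rho2 a r θ * (deriv (fun r' => I2 a m r' θ) r) ^ 2 +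
    Δθ a Λ θ / rho2 a r θ * (deriv (fun θ' => I2 a m r θ') θ) ^ 2

/-- The gradient invariant `I₇ = ∇_μ I₁ ∇^μ I₂
  = (Δ_r/ρ²)(∂_r I₁)(∂_r I₂) + (Δ_θ/ρ²)(∂_θ I₁)(∂_θ I₂)`. -/
def I7 (a m Λ r θ : ℝ) : ℝ :=
  Δr a m Λ r / rho2 a r θ *
      (deriv (fun r' => I1 a m r' θ) r) * (deriv (fun r' => I2 a m r' θ) r) +
    Δθ a Λ θ / rho2 a r θ *
      (deriv (fun θ' => I1 a m r θ') θ) * (deriv (fun θ' => I2 a m r θ') θ)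

/-- The ergosurface polynomial
`E = Λa⁴c⁴ − Λa⁴c² − Λa²r² − Λr⁴ + 3a²c² − 6mr + 3r²`, `c = cos θ`. -/
def E (a m Λ r θ : ℝ) : ℝ :=
  Λ * a ^ 4 * Real.cos θ ^ 4 - Λ * a ^ 4 * Real.cos θ ^ 2 - Λ * a ^ 2 * r ^ 2 - Λ * r ^ 4 +
    3 * a ^ 2 * Real.cos θ ^ 2 - 6 * m * r + 3 * r ^ 2

/-- The differential Weyl invariant `I₃ = ∇_μ C_{αβγδ} ∇^μ C^{αβγδ}`
(explicit closed form). -/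
def I3 (a m Λ r θ : ℝ) : ℝ :=
  240 * m ^ 2 / rho2 a r θ ^ 9 *
    (a ^ 4 * Real.cos θ ^ 4 - 4 * a ^ 3 * Real.cos θ ^ 3 * r
      - 6 * a ^ 2 * Real.cos θ ^ 2 * r ^ 2 + 4 * a * Real.cos θ * r ^ 3 + r ^ 4) *
    (a ^ 4 * Real.cos θ ^ 4 + 4 * a ^ 3 * Real.cos θ ^ 3 * r
      - 6 * a ^ 2 * Real.cos θ ^ 2 * r ^ 2 - 4 * a * Real.cos θ * r ^ 3 + r ^ 4) *
    E a m Λ r θ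

/-- The mixed differential Weyl invariant `I₄ = ∇_μ C_{αβγδ} ∇^μ C*^{αβγδ}`
(explicit closed form). -/
def I4 (a m Λ r θ : ℝ) : ℝ :=
  1920 * a * Real.cos θ * r * m ^ 2 / rho2 a r θ ^ 9 * E a m Λ r θ *
    (a ^ 2 * Real.cos θ ^ 2 - 2 * a * Real.cos θ * r - r ^ 2) *
    (a ^ 2 * Real.cos θ ^ 2 + 2 * a * Real.cos θ * r - r ^ 2) *
    (a ^ 2 * Real.cos θ ^ 2 - r ^ 2)

end KerrAdS

namespace KerrAdS

/-- The Abdelqader–Lake invariant `Q₃ = (1/(6√3)) (I₅ + I₆)/(I₁² + I₂²)^{5/4}`. -/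
def Q3 (a m Λ r θ : ℝ) : ℝ :=
  1 / (6 * Real.sqrt 3) * (I5 a m Λ r θ + I6 a m Λ r θ) /
    (I1 a m r θ ^ 2 + I2 a m r θ ^ 2) ^ ((5 : ℝ) / 4)

/-- `I₁ + i I₂ = 48 m² / (r + i a cos θ)⁶`. -/
lemma Ic_eq_inv (a m r θ : ℝ) :
    Ic a m r θ = 48 * (m : ℂ) ^ 2 * (((r : ℂ) + Complex.I * ((a * Real.cos θ : ℝ) : ℂ)) ^ 6)⁻¹ := by
  have hrho : ((rho2 a r θ : ℝ) : ℂ) =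
      ((r : ℂ) - Complex.I * ((a * Real.cos θ : ℝ) : ℂ)) *
        ((r : ℂ) + Complex.I * ((a * Real.cos θ : ℝ) : ℂ)) := by
    simp only [rho2]
    push_cast
    linear_combination ((a : ℂ) ^ 2 * Complex.cos θ ^ 2) * Complex.I_sq
  have hconj : (r : ℂ) - Complex.I * ((a * Real.cos θ : ℝ) : ℂ) =
      (starRingEnd ℂ) ((r : ℂ) + Complex.I * ((a * Real.cos θ : ℝ) : ℂ)) := by
    simp only [map_add, map_mul, Complex.conj_I, Complex.conj_ofReal]
    ring
  rw [Ic, hrho]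
  by_cases hz : (r : ℂ) + Complex.I * ((a * Real.cos θ : ℝ) : ℂ) = 0
  · rw [hz]
    simp
  · have hw : (r : ℂ) - Complex.I * ((a * Real.cos θ : ℝ) : ℂ) ≠ 0 := by
      rw [hconj]
      exact (map_ne_zero _).2 hz
    field_simp

lemma normSq_radius (a r θ : ℝ) :
    Complex.normSq ((r : ℂ) + Complex.I * ((a * Real.cos θ : ℝ) : ℂ)) = rho2 a r θ := by
  rw [mul_comm, Complex.normSq_add_mul_I, rho2]
  ring

lemma radius_ne_zero {a r θ : ℝ} (h : 0 < rho2 a r θ) :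
    (r : ℂ) + Complex.I * ((a * Real.cos θ : ℝ) : ℂ) ≠ 0 := by
  rw [← Complex.normSq_pos, normSq_radius]
  exact h

lemma hasDerivAt_inv_pow_six {f : ℝ → ℂ} {f' : ℂ} {x : ℝ} (c : ℂ) (hf : HasDerivAt f f' x)
    (hx : f x ≠ 0) :
    HasDerivAt (fun y => c * (f y ^ 6)⁻¹) (-6 * c * f' / f x ^ 7) x := by
  refine (((hf.fun_pow 6).fun_inv (pow_ne_zero 6 hx)).const_mul c).congr_deriv ?_
  field_simp
  push_cast
  ring

lemma hasDerivAt_Ic_r {a r θ : ℝ} (m : ℝ) (h : 0 < rho2 a r θ) :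
    HasDerivAt (fun r' => Ic a m r' θ)
      (-6 * (48 * (m : ℂ) ^ 2) * 1 / ((r : ℂ) + Complex.I * ((a * Real.cos θ : ℝ) : ℂ)) ^ 7) r := by
  simp only [Ic_eq_inv]
  exact hasDerivAt_inv_pow_six _ ((HasDerivAt.ofReal_comp (hasDerivAt_id r)).add_const _)
    (radius_ne_zero h)

lemma hasDerivAt_Ic_θ {a r θ : ℝ} (m : ℝ) (h : 0 < rho2 a r θ) :
    HasDerivAt (fun θ' => Ic a m r θ')
      (-6 * (48 * (m : ℂ) ^ 2) * (Complex.I * ((a * -Real.sin θ : ℝ) : ℂ)) /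
        ((r : ℂ) + Complex.I * ((a * Real.cos θ : ℝ) : ℂ)) ^ 7) θ := by
  simp only [Ic_eq_inv]
  exact hasDerivAt_inv_pow_six _
    (((((Real.hasDerivAt_cos θ).const_mul a).ofReal_comp).const_mul Complex.I).const_add _)
    (radius_ne_zero h)

/-- The squared derivatives of the real and imaginary parts add up to the squared modulus of the
complex derivative. -/
lemma deriv_re_sq_add_deriv_im_sq {f : ℝ → ℂ} {f' : ℂ} {x : ℝ} (hf : HasDerivAt f f' x) :
    deriv (fun y => (f y).re) x ^ 2 + deriv (fun y => (f y).im) x ^ 2 = Complex.normSq f' := by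
  have hre : HasDerivAt (fun y => (f y).re) f'.re x :=
    Complex.reCLM.hasFDerivAt.comp_hasDerivAt x hf
  have him : HasDerivAt (fun y => (f y).im) f'.im x :=
    Complex.imCLM.hasFDerivAt.comp_hasDerivAt x hf
  rw [hre.deriv, him.deriv, Complex.normSq_apply]
  ring

lemma deriv_r_sq_sum {a r θ : ℝ} (m : ℝ) (h : 0 < rho2 a r θ) :
    deriv (fun r' => I1 a m r' θ) r ^ 2 + deriv (fun r' => I2 a m r' θ) r ^ 2 =
      (288 * m ^ 2) ^ 2 / rho2 a r θ ^ 7 := by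
  refine (deriv_re_sq_add_deriv_im_sq (hasDerivAt_Ic_r m h)).trans ?_
  have hcoef : -6 * (48 * (m : ℂ) ^ 2) * 1 = ((-288 * m ^ 2 : ℝ) : ℂ) := by
    push_cast
    ring
  rw [hcoef, map_div₀, map_pow, normSq_radius, Complex.normSq_ofReal]
  ring

lemma deriv_θ_sq_sum {a r θ : ℝ} (m : ℝ) (h : 0 < rho2 a r θ) :
    deriv (fun θ' => I1 a m r θ') θ ^ 2 + deriv (fun θ' => I2 a m r θ') θ ^ 2 =
      (288 * m ^ 2) ^ 2 * (a ^ 2 * Real.sin θ ^ 2) / rho2 a r θ ^ 7 := by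
  refine (deriv_re_sq_add_deriv_im_sq (hasDerivAt_Ic_θ m h)).trans ?_
  have hcoef : -6 * (48 * (m : ℂ) ^ 2) * (Complex.I * ((a * -Real.sin θ : ℝ) : ℂ)) =
      Complex.I * ((288 * m ^ 2 * (a * Real.sin θ) : ℝ) : ℂ) := by
    push_cast
    ring
  rw [hcoef, map_div₀, map_pow, normSq_radius, map_mul, Complex.normSq_I, Complex.normSq_ofReal]
  ring

lemma I5_add_I6 {a r θ : ℝ} (m Λ : ℝ) (h : 0 < rho2 a r θ) :
    I5 a m Λ r θ + I6 a m Λ r θ =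
      (288 * m ^ 2) ^ 2 * (Δr a m Λ r + Δθ a Λ θ * (a ^ 2 * Real.sin θ ^ 2)) /
        rho2 a r θ ^ 8 := by
  have hsplit : I5 a m Λ r θ + I6 a m Λ r θ =
      Δr a m Λ r / rho2 a r θ *
          (deriv (fun r' => I1 a m r' θ) r ^ 2 + deriv (fun r' => I2 a m r' θ) r ^ 2) +
        Δθ a Λ θ / rho2 a r θ *
          (deriv (fun θ' => I1 a m r θ') θ ^ 2 + deriv (fun θ' => I2 a m r θ') θ ^ 2) := by
    rw [I5, I6]
    ring
  rw [hsplit, deriv_r_sq_sum m h, deriv_θ_sq_sum m h]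
  have := h.ne'
  field_simp

lemma I1_sq_add_I2_sq (a m r θ : ℝ) :
    I1 a m r θ ^ 2 + I2 a m r θ ^ 2 = (48 * m ^ 2) ^ 2 / rho2 a r θ ^ 6 := by
  have hnorm : I1 a m r θ ^ 2 + I2 a m r θ ^ 2 = Complex.normSq (Ic a m r θ) := by
    rw [I1, I2, Complex.normSq_apply]
    ring
  have hcoef : 48 * (m : ℂ) ^ 2 = ((48 * m ^ 2 : ℝ) : ℂ) := by
    push_cast
    ring
  rw [hnorm, Ic_eq_inv, hcoef, map_mul, map_inv₀, map_pow, normSq_radius, Complex.normSq_ofReal]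
  ring

lemma I1_sq_add_I2_sq_rpow {a m r θ : ℝ} (hm : 0 < m) (h : 0 < rho2 a r θ) :
    (I1 a m r θ ^ 2 + I2 a m r θ ^ 2) ^ ((5 : ℝ) / 4) =
      (4 * Real.sqrt 3 * m / Real.sqrt (rho2 a r θ) ^ 3) ^ 5 := by
  have hbase : I1 a m r θ ^ 2 + I2 a m r θ ^ 2 =
      (4 * Real.sqrt 3 * m / Real.sqrt (rho2 a r θ) ^ 3) ^ 4 := by
    have hnum : (4 * Real.sqrt 3 * m) ^ 4 = (48 * m ^ 2) ^ 2 := by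
      calc (4 * Real.sqrt 3 * m) ^ 4 = 256 * (Real.sqrt 3 ^ 2) ^ 2 * m ^ 4 := by ring
        _ = (48 * m ^ 2) ^ 2 := by
          rw [Real.sq_sqrt (by norm_num)]
          ring
    have hden : (Real.sqrt (rho2 a r θ) ^ 3) ^ 4 = rho2 a r θ ^ 6 := by
      calc (Real.sqrt (rho2 a r θ) ^ 3) ^ 4 = (Real.sqrt (rho2 a r θ) ^ 2) ^ 6 := by ring
        _ = rho2 a r θ ^ 6 := by rw [Real.sq_sqrt h.le]
    rw [I1_sq_add_I2_sq, div_pow, hnum, hden]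
  have hpos : 0 ≤ 4 * Real.sqrt 3 * m / Real.sqrt (rho2 a r θ) ^ 3 := by positivity
  rw [hbase, ← Real.rpow_natCast, ← Real.rpow_natCast _ 5, ← Real.rpow_mul hpos]
  norm_num

/-- For the Kerr–(anti-)de Sitter black hole with `m > 0`, the
Abdelqader–Lake invariant `Q₃` has the stated closed form. -/
theorem Q3_closed_form (a m Λ : ℝ) (hm : 0 < m) (r θ : ℝ) (h : 0 < rho2 a r θ) :
    Q3 a m Λ r θ =
      (-Λ * a ^ 4 * Real.cos θ ^ 4 - 3 * a ^ 2 * Real.cos θ ^ 2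
        + Λ * a ^ 4 * Real.cos θ ^ 2 - Λ * a ^ 2 * r ^ 2 + 6 * a ^ 2 - Λ * r ^ 4
        - 6 * m * r + 3 * r ^ 2) /
      (6 * m * Real.sqrt (rho2 a r θ)) := by
  have hs : 0 < Real.sqrt (rho2 a r θ) := Real.sqrt_pos.2 h
  have h3 : 0 < Real.sqrt 3 := Real.sqrt_pos.2 (by norm_num)
  have hnum : -Λ * a ^ 4 * Real.cos θ ^ 4 - 3 * a ^ 2 * Real.cos θ ^ 2
        + Λ * a ^ 4 * Real.cos θ ^ 2 - Λ * a ^ 2 * r ^ 2 + 6 * a ^ 2 - Λ * r ^ 4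
        - 6 * m * r + 3 * r ^ 2 =
      3 * (Δr a m Λ r + Δθ a Λ θ * (a ^ 2 * Real.sin θ ^ 2)) := by
    rw [Real.sin_sq, Δr, Δθ]
    ring
  have hrho : rho2 a r θ ^ 8 = Real.sqrt (rho2 a r θ) ^ 16 := by
    calc rho2 a r θ ^ 8 = (Real.sqrt (rho2 a r θ) ^ 2) ^ 8 := by rw [Real.sq_sqrt h.le]
      _ = Real.sqrt (rho2 a r θ) ^ 16 := by ring
  have h3pow : Real.sqrt 3 ^ 6 = 27 := by
    calc Real.sqrt 3 ^ 6 = (Real.sqrt 3 ^ 2) ^ 3 := by ring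
      _ = 27 := by
        rw [Real.sq_sqrt (by norm_num)]
        norm_num
  rw [Q3, I1_sq_add_I2_sq_rpow hm h, I5_add_I6 m Λ h, hnum, hrho]
  generalize Δr a m Λ r + Δθ a Λ θ * (a ^ 2 * Real.sin θ ^ 2) = D
  field_simp
  rw [h3pow]
  ring

end KerrAdS
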